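/- If a 3×3 real matrix X lies on the topological boundary of the convex hull of SO(3), then det M(X) = 0, where M(X) is the associated symmetric 4×4 matrix. -/

import Mathlib

/-- SO(3): the set of 3×3 real matrices `R` with `R * Rᵀ = 1` and `det R = 1`. -/
def SO3 : Set (Matrix (Fin 3) (Fin 3) ℝ) :=
  {R | R * R.transpose = 1 ∧ R.det = 1}

/-- The symmetric 4×4 matrix `M(X)` associated to a 3×3 matrix `X`. -/
def MX (X : Matrix (Fin 3) (Fin 3) ℝ) : Matrix (Fin 4) (Fin 4) ℝ :=
  !![1 + X 0 0 + X 1 1 + X 2 2, X 2 1 - X 1 2, X 0 2 - X 2 0, X 1 0 - X 0 1;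
     X 2 1 - X 1 2, 1 + X 0 0 - X 1 1 - X 2 2, X 1 0 + X 0 1, X 0 2 + X 2 0;
     X 0 2 - X 2 0, X 1 0 + X 0 1, 1 - X 0 0 + X 1 1 - X 2 2, X 2 1 + X 1 2;
     X 1 0 - X 0 1, X 0 2 + X 2 0, X 2 1 + X 1 2, 1 - X 0 0 - X 1 1 + X 2 2]

open Matrix in
theorem isSymm_MX (X : Matrix (Fin 3) (Fin 3) ℝ) : (MX X)ᵀ = MX X := by
  ext i j
  fin_cases i <;> fin_cases j <;> rfl

theorem continuous_MX : Continuous MX := by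
  refine continuous_matrix fun i j => ?_
  fin_cases i <;> fin_cases j <;> simp only [MX] <;> simp <;> fun_prop

theorem MX_combo (X Y : Matrix (Fin 3) (Fin 3) ℝ) {a b : ℝ} (hab : a + b = 1) :
    MX (a • X + b • Y) = a • MX X + b • MX Y := by
  obtain rfl : b = 1 - a := by linarith
  ext i j
  fin_cases i <;> fin_cases j <;> simp [MX] <;> ring

/-- On rotations, `M(R) / 4` is idempotent. -/
theorem MX_mul_self_of_mem_SO3 {R : Matrix (Fin 3) (Fin 3) ℝ} (hR : R ∈ SO3) :
    MX R * MX R = (4 : ℝ) • MX R := by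
  obtain ⟨h1, h2⟩ := hR
  have h3 : R.transpose * R = 1 := mul_eq_one_comm.mp h1
  have h4 : R.adjugate = R.transpose := by
    calc R.adjugate = R.transpose * R * R.adjugate := by rw [h3, one_mul]
      _ = R.transpose := by rw [mul_assoc, Matrix.mul_adjugate, h2, one_smul, mul_one]
  rw [Matrix.adjugate_fin_three] at h4
  simp only [← Matrix.ext_iff, Fin.forall_fin_succ, Matrix.mul_apply, Fin.sum_univ_succ,
    Matrix.transpose_apply, Matrix.one_apply] at h1 h3 h4
  simp at h1 h3 h4
  ext i j
  fin_cases i <;> fin_cases j <;>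
    simp [MX, Matrix.mul_apply, Fin.sum_univ_succ] <;> linarith

open Matrix in
theorem dotProduct_MX_nonneg_of_mem_SO3 {R : Matrix (Fin 3) (Fin 3) ℝ} (hR : R ∈ SO3)
    (v : Fin 4 → ℝ) : 0 ≤ v ⬝ᵥ (MX R *ᵥ v) := by
  have h : (MX R *ᵥ v) ⬝ᵥ (MX R *ᵥ v) = 4 * (v ⬝ᵥ (MX R *ᵥ v)) := by
    rw [dotProduct_mulVec (MX R *ᵥ v), ← mulVec_transpose, isSymm_MX, mulVec_mulVec,
      MX_mul_self_of_mem_SO3 hR, smul_mulVec, smul_dotProduct, smul_eq_mul,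
      dotProduct_comm]
  have h' : 0 ≤ (MX R *ᵥ v) ⬝ᵥ (MX R *ᵥ v) :=
    Finset.sum_nonneg fun i _ => mul_self_nonneg _
  linarith

open Matrix in
theorem dotProduct_MX_nonneg_of_mem_closure {X : Matrix (Fin 3) (Fin 3) ℝ}
    (hX : X ∈ closure (convexHull ℝ SO3)) (v : Fin 4 → ℝ) : 0 ≤ v ⬝ᵥ (MX X *ᵥ v) := by
  have hcont : Continuous fun Y => v ⬝ᵥ (MX Y *ᵥ v) :=
    continuous_const.dotProduct (continuous_MX.matrix_mulVec continuous_const)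
  have hconv : Convex ℝ {Y : Matrix (Fin 3) (Fin 3) ℝ | 0 ≤ v ⬝ᵥ (MX Y *ᵥ v)} := by
    intro Y hY Z hZ a b ha hb hab
    simp only [Set.mem_ofPred_eq] at hY hZ ⊢
    rw [MX_combo Y Z hab, add_mulVec, smul_mulVec, smul_mulVec, dotProduct_add,
      dotProduct_smul, dotProduct_smul, smul_eq_mul, smul_eq_mul]
    positivity
  exact closure_minimal (convexHull_min (fun R hR => dotProduct_MX_nonneg_of_mem_SO3 hR v) hconv)
    (isClosed_le continuous_const hcont) hX

/-- The homogeneous quadratic parametrization of multiples of rotations by quaternions. -/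
def quaternionMatrix (v : Fin 4 → ℝ) : Matrix (Fin 3) (Fin 3) ℝ :=
  !![v 0 ^ 2 + v 1 ^ 2 - v 2 ^ 2 - v 3 ^ 2, 2 * (v 1 * v 2 - v 0 * v 3),
      2 * (v 1 * v 3 + v 0 * v 2);
    2 * (v 1 * v 2 + v 0 * v 3), v 0 ^ 2 - v 1 ^ 2 + v 2 ^ 2 - v 3 ^ 2,
      2 * (v 2 * v 3 - v 0 * v 1);
    2 * (v 1 * v 3 - v 0 * v 2), 2 * (v 2 * v 3 + v 0 * v 1),
      v 0 ^ 2 - v 1 ^ 2 - v 2 ^ 2 + v 3 ^ 2]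

theorem quaternionMatrix_mem_SO3 {v : Fin 4 → ℝ} (hv : ∑ i, v i ^ 2 = 1) :
    quaternionMatrix v ∈ SO3 := by
  rw [Fin.sum_univ_four] at hv
  have h0 : v 0 ^ 2 = 1 - v 1 ^ 2 - v 2 ^ 2 - v 3 ^ 2 := by linarith
  constructor
  · ext i j
    fin_cases i <;> fin_cases j <;>
      simp [quaternionMatrix, Matrix.mul_apply, Fin.sum_univ_succ] <;> ring_nf <;> grind
  · rw [Matrix.det_fin_three]
    simp [quaternionMatrix]
    have : (v 0 ^ 2 + v 1 ^ 2 + v 2 ^ 2 + v 3 ^ 2) ^ 3 = 1 := by rw [hv, one_pow]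
    rw [← this]
    ring

theorem quaternionMatrix_smul (c : ℝ) (v : Fin 4 → ℝ) :
    quaternionMatrix (c • v) = c ^ 2 • quaternionMatrix v := by
  ext i j
  fin_cases i <;> fin_cases j <;> simp [quaternionMatrix] <;> ring

theorem exists_mem_SO3_quaternionMatrix_eq_smul (v : Fin 4 → ℝ) :
    ∃ R ∈ SO3, quaternionMatrix v = (∑ i, v i ^ 2) • R := by
  have hn : 0 ≤ ∑ i, v i ^ 2 := Finset.sum_nonneg fun i _ => sq_nonneg _
  rcases hn.eq_or_lt with h | h
  · refine ⟨1, by simp [SO3], ?_⟩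
    have hv : v = 0 := by
      ext i
      have := (Finset.sum_eq_zero_iff_of_nonneg fun i _ => sq_nonneg (v i)).mp h.symm i
        (Finset.mem_univ i)
      simpa using this
    rw [← h, zero_smul, hv]
    simpa using quaternionMatrix_smul 0 0
  · set c := √(∑ i, v i ^ 2) with hc
    have hc2 : c ^ 2 = ∑ i, v i ^ 2 := Real.sq_sqrt hn
    have hc0 : c ≠ 0 := (Real.sqrt_pos.mpr h).ne'
    refine ⟨quaternionMatrix (c⁻¹ • v), quaternionMatrix_mem_SO3 ?_, ?_⟩
    · simp only [Pi.smul_apply, smul_eq_mul, mul_pow]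
      rw [← Finset.mul_sum, ← hc2, ← mul_pow, inv_mul_cancel₀ hc0, one_pow]
    · rw [← hc2, ← quaternionMatrix_smul, smul_inv_smul₀ hc0]

open scoped MatrixOrder in
theorem Matrix.PosSemidef.exists_eq_conjTranspose_mul_self {n : Type*} [Fintype n]
    {A : Matrix n n ℝ} (hA : A.PosSemidef) : ∃ B : Matrix n n ℝ, A = B.conjTranspose * B := by
  classical
  exact CStarAlgebra.nonneg_iff_eq_star_mul_self.mp hA.nonneg

theorem mem_convexHull_SO3_of_posSemidef {X : Matrix (Fin 3) (Fin 3) ℝ}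
    (hX : (MX X).PosSemidef) : X ∈ convexHull ℝ SO3 := by
  obtain ⟨B, hB⟩ := hX.exists_eq_conjTranspose_mul_self
  have hsum : ∀ i j, ∑ k, B k i * B k j = MX X i j := fun i j => by
    simp [hB, Matrix.mul_apply]
  choose R hR hBR using fun k => exists_mem_SO3_quaternionMatrix_eq_smul (B k)
  have hXR : X = ∑ k, ((∑ i, B k i ^ 2) / 4) • R k := by
    have : X = (1 / 4 : ℝ) • ∑ k, quaternionMatrix (B k) := by
      simp only [Fin.forall_fin_succ, Fin.sum_univ_four, MX] at hsum
      simp at hsum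
      ext i j
      fin_cases i <;> fin_cases j <;>
        simp [quaternionMatrix, Fin.sum_univ_four] <;> linarith
    rw [this, Finset.smul_sum]
    refine Finset.sum_congr rfl fun k _ => ?_
    rw [hBR, smul_smul]
    congr 1
    ring
  rw [hXR]
  refine (convex_convexHull ℝ SO3).sum_mem (fun k _ => ?_) ?_
    fun k _ => subset_convexHull ℝ SO3 (hR k)
  · exact div_nonneg (Finset.sum_nonneg fun i _ => sq_nonneg _) (by norm_num)
  · simp only [Fin.forall_fin_succ, Fin.sum_univ_four, MX] at hsum ⊢
    simp at hsum
    linarith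

open Matrix Topology in
/-- Positive definiteness of real matrices is stable under small perturbations. -/
theorem Matrix.PosDef.eventually_dotProduct_pos {n : Type*} [Fintype n]
    {A : Matrix n n ℝ} (hA : A.PosDef) :
    ∀ᶠ B in 𝓝 A, ∀ v : n → ℝ, v ≠ 0 → 0 < v ⬝ᵥ (B *ᵥ v) := by
  have hcont : Continuous fun p : Matrix n n ℝ × (n → ℝ) => p.2 ⬝ᵥ (p.1 *ᵥ p.2) :=
    continuous_snd.dotProduct (continuous_fst.matrix_mulVec continuous_snd)
  have h : ∀ᶠ B in 𝓝 A, ∀ v ∈ Metric.sphere (0 : n → ℝ) 1, 0 < v ⬝ᵥ (B *ᵥ v) := by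
    refine (isCompact_sphere _ _).eventually_forall_of_forall_eventually fun v hv => ?_
    refine hcont.continuousAt.eventually_const_lt ?_
    have hv0 : v ≠ 0 := ne_zero_of_mem_unit_sphere ⟨v, hv⟩
    simpa using hA.dotProduct_mulVec_pos hv0
  filter_upwards [h] with B hB v hv
  have hv' : 0 < ‖v‖ := norm_pos_iff.mpr hv
  have := hB (‖v‖⁻¹ • v) (by simp [norm_smul, hv'.ne'])
  rw [mulVec_smul, dotProduct_smul, smul_dotProduct, smul_eq_mul, smul_eq_mul] at this
  have hi : 0 < ‖v‖⁻¹ := inv_pos.mpr hv'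
  exact pos_of_mul_pos_right (pos_of_mul_pos_right this hi.le) hi.le

theorem posSemidef_MX {X : Matrix (Fin 3) (Fin 3) ℝ}
    (h : ∀ v : Fin 4 → ℝ, 0 ≤ v ⬝ᵥ (MX X).mulVec v) : (MX X).PosSemidef :=
  .of_dotProduct_mulVec_nonneg (isSymm_MX X) (by simpa using h)

theorem det_MX_eq_zero_of_mem_frontier (X : Matrix (Fin 3) (Fin 3) ℝ)
    (hX : X ∈ frontier (convexHull ℝ SO3)) :
    (MX X).det = 0 := by
  by_contra hdet
  have hpos : (MX X).PosDef :=
    (posSemidef_MX (dotProduct_MX_nonneg_of_mem_closure hX.1)).posDef_iff_isUnit.mpr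
      ((Matrix.isUnit_iff_isUnit_det _).mpr (isUnit_iff_ne_zero.mpr hdet))
  refine hX.2 (mem_interior_iff_mem_nhds.mpr ?_)
  filter_upwards [continuous_MX.continuousAt.eventually hpos.eventually_dotProduct_pos] with Y hY
  refine mem_convexHull_SO3_of_posSemidef (posSemidef_MX fun v => ?_)
  rcases eq_or_ne v 0 with rfl | hv
  · simp
  · exact (hY v hv).le
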